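/- arXiv:2001.00936 — 2 statements merged into one kernel-verified Lean document; each statement's English description precedes it below -/
import Mathlib

section
/- Truth Lemma: Assume L is countable. For every prime saturated BQL_CD-theory Γ and every L⁺-sentence φ: C, Γ ⊩ φ if and only if φ ∈ Γ, where C is the canonical model. -/
universe u v

namespace BQL

structure Signature : Type 1 where
  Const : Type
  Func : Type
  arityF : Func → ℕ
  Rel : Type
  arityR : Rel → ℕ

inductive Term (L : Signature) : Type
  | var : ℕ → Term L
  | const : L.Const → Term L
  | func : (f : L.Func) → (Fin (L.arityF f) → Term L) → Term L

inductive Formula (L : Signature) : Type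
  | top : Formula L
  | bot : Formula L
  | rel : (R : L.Rel) → (Fin (L.arityR R) → Term L) → Formula L
  | and : Formula L → Formula L → Formula L
  | or : Formula L → Formula L → Formula L
  | imp : Formula L → Formula L → Formula L
  | all : Formula L → Formula L
  | ex : Formula L → Formula L

variable {L : Signature}

namespace Term

/-- Shift all (free) variables of a term up by one. -/
def shiftUp : Term L → Term L
  | var n => var (n + 1)
  | const c => const c
  | func f ts => func f fun i => (ts i).shiftUp

/-- Apply a simultaneous substitution to a term. -/
def applySub (σ : ℕ → Term L) : Term L → Term L
  | var n => σ n
  | const c => const c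
  | func f ts => func f fun i => (ts i).applySub σ

/-- All variables of the term are `< k`. -/
def ClosedAt : Term L → ℕ → Prop
  | var n, k => n < k
  | const _, _ => True
  | func _ ts, k => ∀ i, (ts i).ClosedAt k

/-- A closed term. -/
def Closed (t : Term L) : Prop := t.ClosedAt 0

/-- The constant `c` occurs in the term. -/
def OccC (c : L.Const) : Term L → Prop
  | var _ => False
  | const d => d = c
  | func _ ts => ∃ i, (ts i).OccC c

end Term

/-- Lift a substitution under a binder. -/
def liftSub (σ : ℕ → Term L) : ℕ → Term L
  | 0 => .var 0
  | n + 1 => (σ n).shiftUp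

namespace Formula

/-- Apply a simultaneous substitution to a formula. -/
def applySub (σ : ℕ → Term L) : Formula L → Formula L
  | top => top
  | bot => bot
  | rel R ts => rel R fun i => (ts i).applySub σ
  | and φ ψ => and (φ.applySub σ) (ψ.applySub σ)
  | or φ ψ => or (φ.applySub σ) (ψ.applySub σ)
  | imp φ ψ => imp (φ.applySub σ) (ψ.applySub σ)
  | all φ => all (φ.applySub (liftSub σ))
  | ex φ => ex (φ.applySub (liftSub σ))

/-- All free variables of the formula are `< k`. -/
def ClosedAt : Formula L → ℕ → Prop
  | top, _ => True
  | bot, _ => True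
  | rel _ ts, k => ∀ i, (ts i).ClosedAt k
  | and φ ψ, k => φ.ClosedAt k ∧ ψ.ClosedAt k
  | or φ ψ, k => φ.ClosedAt k ∧ ψ.ClosedAt k
  | imp φ ψ, k => φ.ClosedAt k ∧ ψ.ClosedAt k
  | all φ, k => φ.ClosedAt (k + 1)
  | ex φ, k => φ.ClosedAt (k + 1)

/-- A sentence: a formula with no free variables. -/
def Sentence (φ : Formula L) : Prop := φ.ClosedAt 0

/-- The constant `c` occurs in the formula. -/
def OccC (c : L.Const) : Formula L → Prop
  | top => False
  | bot => False
  | rel _ ts => ∃ i, (ts i).OccC c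
  | and φ ψ => φ.OccC c ∨ ψ.OccC c
  | or φ ψ => φ.OccC c ∨ ψ.OccC c
  | imp φ ψ => φ.OccC c ∨ ψ.OccC c
  | all φ => φ.OccC c
  | ex φ => φ.OccC c

/-- The formula contains no occurrence of `∨` and no occurrence of `∃`. -/
def NoOrEx : Formula L → Prop
  | top => True
  | bot => True
  | rel _ _ => True
  | and φ ψ => φ.NoOrEx ∧ ψ.NoOrEx
  | or _ _ => False
  | imp φ ψ => φ.NoOrEx ∧ ψ.NoOrEx
  | all φ => φ.NoOrEx
  | ex _ => False

end Formula

/-- Substitute the term `t` for the variable `v₀` (lowering the other variables). -/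
def subst0 (φ : Formula L) (t : Term L) : Formula L :=
  φ.applySub fun n => match n with | 0 => t | n + 1 => .var n

/-- `□ⁿφ`, where `□φ` abbreviates `⊤ → φ`. -/
def boxN : ℕ → Formula L → Formula L
  | 0, φ => φ
  | n + 1, φ => .imp .top (boxN n φ)

/-- The conjunction of a finite list of formulas (`⋀∅ = ⊤`). -/
def conjL : List (Formula L) → Formula L
  | [] => .top
  | [φ] => φ
  | φ :: ψ :: l => .and φ (conjL (ψ :: l))

/-- The language `L⁺`, obtained from `L` by adding countably many fresh constants `aᵢ`. -/
def Signature.plus (L : Signature) : Signature where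
  Const := L.Const ⊕ ℕ
  Func := L.Func
  arityF := L.arityF
  Rel := L.Rel
  arityR := L.arityR

/-- The fresh constant `aᵢ` of `L⁺`. -/
def aconst (L : Signature) (i : ℕ) : Term L.plus := .const (Sum.inr i)

/-- Embedding of `L`-terms into `L⁺`-terms. -/
def Term.emb : Term L → Term L.plus
  | .var n => .var n
  | .const c => .const (Sum.inl c)
  | .func f ts => .func f fun i => (ts i).emb

/-- Embedding of `L`-formulas into `L⁺`-formulas. -/
def Formula.emb : Formula L → Formula L.plus
  | .top => .top
  | .bot => .bot
  | .rel R ts => .rel R fun i => (ts i).emb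
  | .and φ ψ => .and φ.emb ψ.emb
  | .or φ ψ => .or φ.emb ψ.emb
  | .imp φ ψ => .imp φ.emb ψ.emb
  | .all φ => .all φ.emb
  | .ex φ => .ex φ.emb

/-- The fresh constant `aᵢ` occurs in no member of `Γ`. -/
def FreshIn (i : ℕ) (Γ : Set (Formula L.plus)) : Prop :=
  ∀ ψ ∈ Γ, ¬ ψ.OccC (Sum.inr i)

/-- A Kripke `L`-model (the frame conditions are packaged in `KModel.Proper`). -/
structure KModel (L : Signature) : Type (u + 1) where
  W : Type u
  acc : W → W → Prop
  D : Type u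
  interpC : L.Const → D
  interpF : (f : L.Func) → (Fin (L.arityF f) → D) → D
  interpR : (R : L.Rel) → W → Set (Fin (L.arityR R) → D)

/-- The conditions on an `L`-model: nonempty set of worlds, transitive accessibility
relation, nonempty domain, and the persistence constraint. -/
def KModel.Proper (M : KModel.{u} L) : Prop :=
  Nonempty M.W ∧ Nonempty M.D ∧ Transitive M.acc ∧
    ∀ (R : L.Rel) (w u' : M.W), M.acc w u' → M.interpR R w ⊆ M.interpR R u'

/-- Prepend a value to a valuation. -/
def vcons {α : Sort*} (d : α) (ρ : ℕ → α) : ℕ → α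
  | 0 => d
  | n + 1 => ρ n

/-- Denotation of a term. -/
def Term.eval (M : KModel.{u} L) (ρ : ℕ → M.D) : Term L → M.D
  | .var n => ρ n
  | .const c => M.interpC c
  | .func f ts => M.interpF f fun i => (ts i).eval M ρ

/-- The satisfaction relation `w ⊩ φ(ā)`. -/
def Sat (M : KModel.{u} L) : M.W → (ℕ → M.D) → Formula L → Prop
  | _, _, .top => True
  | _, _, .bot => False
  | w, ρ, .rel R ts => (fun i => (ts i).eval M ρ) ∈ M.interpR R w
  | w, ρ, .and φ ψ => Sat M w ρ φ ∧ Sat M w ρ ψ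
  | w, ρ, .or φ ψ => Sat M w ρ φ ∨ Sat M w ρ ψ
  | w, ρ, .imp φ ψ => ∀ u', M.acc w u' → Sat M u' ρ φ → Sat M u' ρ ψ
  | w, ρ, .all φ => ∀ d, Sat M w (vcons d ρ) φ
  | w, ρ, .ex φ => ∃ d, Sat M w (vcons d ρ) φ

/-- Satisfaction of a sentence (under every valuation). -/
def SatS (M : KModel.{u} L) (w : M.W) (φ : Formula L) : Prop := ∀ ρ, Sat M w ρ φ

/-- `Γ ⊨ φ`: truth is preserved at every reflexive world of every `L`-model. -/
def Models (Γ : Set (Formula L)) (φ : Formula L) : Prop :=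
  ∀ M : KModel.{u} L, M.Proper → ∀ w : M.W, M.acc w w →
    (∀ ψ ∈ Γ, SatS M w ψ) → SatS M w φ

/-- `Γ : Δ ⊨ φ`: for every `L`-model, every reflexive world `w` and every world `u ≻ w`:
if `w ⊩ Γ` and `u ⊩ Δ` then `u ⊩ φ`. -/
def ModelsCtx (Γ Δ : Set (Formula L)) (φ : Formula L) : Prop :=
  ∀ M : KModel.{u} L, M.Proper → ∀ w u' : M.W, M.acc w w → M.acc w u' →
    (∀ ψ ∈ Γ, SatS M w ψ) → (∀ ψ ∈ Δ, SatS M u' ψ) → SatS M u' φ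

end BQL

namespace BQL

/-- `PrfN L n Γ Δ φ` formalizes `Γ : Δ ⊢_{[n-1]} φ`: there is a proof of `φ` in the
system `NBQL_CD[n-1]` (so `PrfN L 0` is the system `NBQL_CD`, i.e. `⊢_{[-1]}`, which
has no modus ponens at all) whose open assumptions all belong to `Γ ∪ Δ` and in which
every open assumption occurring unsafely (i.e. in the right main subproof of an
application of the restricted modus ponens rule) belongs to `Γ`.  The restricted
modus ponens rule of `NBQL_CD[n-1]` requires its right main subproof to lie entirely
within `NBQL_CD[m-1]` for some `m < n`. -/
inductive PrfN (L : Signature) :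
    ℕ → Set (Formula L.plus) → Set (Formula L.plus) → Formula L.plus → Prop
  | hyp {n Γ Δ φ} : φ ∈ Γ ∪ Δ → φ.Sentence → PrfN L n Γ Δ φ
  | weaken {n Γ Γ' Δ Δ' φ} : Γ ⊆ Γ' → Δ ⊆ Δ' → PrfN L n Γ Δ φ → PrfN L n Γ' Δ' φ
  | topIntro {n Γ Δ} : PrfN L n Γ Δ .top
  | botElim {n Γ Δ φ} : φ.Sentence → PrfN L n Γ Δ .bot → PrfN L n Γ Δ φ
  | andIntro {n Γ Δ φ ψ} : PrfN L n Γ Δ φ → PrfN L n Γ Δ ψ → PrfN L n Γ Δ (.and φ ψ)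
  | andElimL {n Γ Δ φ ψ} : PrfN L n Γ Δ (.and φ ψ) → PrfN L n Γ Δ φ
  | andElimR {n Γ Δ φ ψ} : PrfN L n Γ Δ (.and φ ψ) → PrfN L n Γ Δ ψ
  | orIntroL {n Γ Δ φ ψ} : ψ.Sentence → PrfN L n Γ Δ φ → PrfN L n Γ Δ (.or φ ψ)
  | orIntroR {n Γ Δ φ ψ} : φ.Sentence → PrfN L n Γ Δ ψ → PrfN L n Γ Δ (.or φ ψ)
  | orElim {n Γ Δ φ ψ χ} : PrfN L n Γ Δ (.or φ ψ) → PrfN L n Γ (insert φ Δ) χ →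
      PrfN L n Γ (insert ψ Δ) χ → PrfN L n Γ Δ χ
  | impIntro {n Γ Δ φ ψ} : φ.Sentence → PrfN L n Γ (insert φ Δ) ψ →
      PrfN L n Γ Δ (.imp φ ψ)
  | impElim {n m Γ Δ φ ψ} : m < n → PrfN L n Γ Δ φ → PrfN L m Γ ∅ (.imp φ ψ) →
      PrfN L n Γ Δ ψ
  | intTrans {n Γ Δ φ ψ χ} : PrfN L n Γ Δ (.imp φ ψ) → PrfN L n Γ Δ (.imp ψ χ) →
      PrfN L n Γ Δ (.imp φ χ)
  | intAndIntro {n Γ Δ φ ψ χ} : PrfN L n Γ Δ (.imp φ ψ) → PrfN L n Γ Δ (.imp φ χ) →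
      PrfN L n Γ Δ (.imp φ (.and ψ χ))
  | intOrElim {n Γ Δ φ ψ χ} : PrfN L n Γ Δ (.imp φ χ) → PrfN L n Γ Δ (.imp ψ χ) →
      PrfN L n Γ Δ (.imp (.or φ ψ) χ)
  | intAllIntro {n Γ Δ φ ψ} : φ.Sentence → PrfN L n Γ Δ (.all (.imp φ ψ)) →
      PrfN L n Γ Δ (.imp φ (.all ψ))
  | intExElim {n Γ Δ φ ψ} : ψ.Sentence → PrfN L n Γ Δ (.all (.imp φ ψ)) →
      PrfN L n Γ Δ (.imp (.ex φ) ψ)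
  | allIntro {n Γ Δ Γ' Δ' φ} {i : ℕ} : Γ' ⊆ Γ → Δ' ⊆ Δ → FreshIn i Γ' → FreshIn i Δ' →
      ¬ φ.OccC (Sum.inr i) → PrfN L n Γ' Δ' (subst0 φ (aconst L i)) →
      PrfN L n Γ Δ (.all φ)
  | allElim {n Γ Δ φ} {t : Term L.plus} : t.Closed → PrfN L n Γ Δ (.all φ) →
      PrfN L n Γ Δ (subst0 φ t)
  | cd {n Γ Δ φ ψ} : φ.Sentence → PrfN L n Γ Δ (.all (.or φ ψ)) →
      PrfN L n Γ Δ (.or φ (.all ψ))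
  | exIntro {n Γ Δ φ} {t : Term L.plus} : t.Closed → (Formula.ex φ).Sentence →
      PrfN L n Γ Δ (subst0 φ t) → PrfN L n Γ Δ (.ex φ)
  | exElim {n Γ Δ Γ' Δ' φ ψ} {i : ℕ} : Γ' ⊆ Γ → Δ' ⊆ Δ → FreshIn i Γ' → FreshIn i Δ' →
      ¬ φ.OccC (Sum.inr i) → ¬ ψ.OccC (Sum.inr i) → PrfN L n Γ Δ (.ex φ) →
      PrfN L n Γ' (insert (subst0 φ (aconst L i)) Δ') ψ → PrfN L n Γ Δ ψ

/-- `Γ ⊢_{[-1]} φ`: there is a proof of `φ` from `Γ` in `NBQL_CD`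
(the system `NBQL_CD^r` with `→`-Elim deleted). -/
def PrvB (L : Signature) (Γ : Set (Formula L.plus)) (φ : Formula L.plus) : Prop :=
  PrfN L 0 Γ ∅ φ

end BQL

namespace BQL

/-- A prime saturated `BQL_CD`-theory: a set of `L⁺`-sentences which is consistent,
closed under `NBQL_CD` (`⊢_{[-1]}`), and has the disjunction, existence and totality
properties. -/
def PST (L : Signature) (Γ : Set (Formula L.plus)) : Prop :=
  (∀ φ ∈ Γ, Formula.Sentence φ) ∧
  Formula.bot ∉ Γ ∧
  (∀ φ : Formula L.plus, φ.Sentence → PrvB L Γ φ → φ ∈ Γ) ∧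
  (∀ φ ψ : Formula L.plus, Formula.or φ ψ ∈ Γ → φ ∈ Γ ∨ ψ ∈ Γ) ∧
  (∀ φ : Formula L.plus, Formula.ex φ ∈ Γ →
    ∃ t : Term L.plus, t.Closed ∧ subst0 φ t ∈ Γ) ∧
  (∀ φ : Formula L.plus, φ.ClosedAt 1 →
    (∀ t : Term L.plus, t.Closed → subst0 φ t ∈ Γ) → Formula.all φ ∈ Γ)

/-- The accessibility relation of the canonical model:
`Γ ≺ Δ` iff for all `α`, `β`: if `α → β ∈ Γ` and `α ∈ Δ` then `β ∈ Δ`. -/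
def canAcc (L : Signature) (Γ Δ : Set (Formula L.plus)) : Prop :=
  ∀ α β : Formula L.plus, Formula.imp α β ∈ Γ → α ∈ Δ → β ∈ Δ

/-- The canonical model: worlds are the prime saturated `BQL_CD`-theories, the domain
is the set of closed `L⁺`-terms, every constant denotes itself, function symbols act
syntactically, and `⟨t₁,...,tₙ⟩ ∈ |R|(Γ)` iff `R(t₁,...,tₙ) ∈ Γ`. -/
def CModel (L : Signature) : KModel.{0} L.plus where
  W := {Γ : Set (Formula L.plus) // PST L Γ}
  acc Γ Δ := canAcc L Γ.1 Δ.1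
  D := {t : Term L.plus // t.Closed}
  interpC c := ⟨Term.const c, trivial⟩
  interpF f ts := ⟨Term.func f fun i => (ts i).1, fun i => (ts i).2⟩
  interpR R Γ := {ts | Formula.rel R (fun i => (ts i).1) ∈ Γ.1}

end BQL

namespace BQL

/-! ### Substitution -/

/-- The substitution underlying `subst0`. -/
theorem subst0_eq {L : Signature} (φ : Formula L) (t : Term L) :
    subst0 φ t = φ.applySub (vcons t Term.var) := by
  unfold subst0
  congr 1

theorem liftSub_var {L : Signature} : liftSub (Term.var : ℕ → Term L) = Term.var := by
  funext n
  cases n <;> rfl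

namespace Term

variable {L : Signature}

theorem applySub_var (t : Term L) : t.applySub Term.var = t := by
  induction t with
  | var n => rfl
  | const c => rfl
  | func f ts ih => simp only [applySub, ih]

theorem applySub_applySub (σ τ : ℕ → Term L) (t : Term L) :
    (t.applySub σ).applySub τ = t.applySub fun n => (σ n).applySub τ := by
  induction t with
  | var n => rfl
  | const c => rfl
  | func f ts ih => simp only [applySub, ih]

theorem applySub_shiftUp (σ : ℕ → Term L) (t : Term L) :
    t.shiftUp.applySub σ = t.applySub fun n => σ (n + 1) := by
  induction t with
  | var n => rfl
  | const c => rfl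
  | func f ts ih => simp only [shiftUp, applySub, ih]

theorem shiftUp_applySub (σ : ℕ → Term L) (t : Term L) :
    (t.applySub σ).shiftUp = t.applySub fun n => (σ n).shiftUp := by
  induction t with
  | var n => rfl
  | const c => rfl
  | func f ts ih => simp only [shiftUp, applySub, ih]

theorem ClosedAt.shiftUp {t : Term L} {k : ℕ} (h : t.ClosedAt k) :
    t.shiftUp.ClosedAt (k + 1) := by
  induction t with
  | var n => exact Nat.succ_lt_succ h
  | const c => trivial
  | func f ts ih => exact fun i => ih i (h i)

theorem ClosedAt.mono {t : Term L} {k m : ℕ} (h : t.ClosedAt k) (hkm : k ≤ m) :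
    t.ClosedAt m := by
  induction t with
  | var n => exact lt_of_lt_of_le h hkm
  | const c => trivial
  | func f ts ih => exact fun i => ih i (h i)

theorem closedAt_applySub {σ : ℕ → Term L} {m : ℕ} (hσ : ∀ n, (σ n).ClosedAt m) (t : Term L) :
    (t.applySub σ).ClosedAt m := by
  induction t with
  | var n => exact hσ n
  | const c => trivial
  | func f ts ih => exact ih

theorem ClosedAt.applySub_congr {t : Term L} {k : ℕ} (h : t.ClosedAt k) {σ τ : ℕ → Term L}
    (hστ : ∀ n < k, σ n = τ n) : t.applySub σ = t.applySub τ := by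
  induction t with
  | var n => exact hστ n h
  | const c => rfl
  | func f ts ih =>
    simp only [applySub]
    congr 1
    funext i
    exact ih i (h i)

theorem finite_occC (t : Term L) : {c | t.OccC c}.Finite := by
  induction t with
  | var n => exact Set.finite_empty
  | const c => exact Set.finite_singleton c |>.subset fun d hd => Eq.symm hd
  | func f ts ih =>
    refine (Set.finite_iUnion ih).subset ?_
    rintro c ⟨i, hi⟩
    exact Set.mem_iUnion.2 ⟨i, hi⟩

end Term

theorem liftSub_comp {L : Signature} (σ τ : ℕ → Term L) :
    (fun n => (liftSub σ n).applySub (liftSub τ)) = liftSub fun n => (σ n).applySub τ := by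
  funext n
  cases n with
  | zero => rfl
  | succ n => exact (Term.applySub_shiftUp _ _).trans (Term.shiftUp_applySub _ _).symm

theorem closedAt_liftSub {L : Signature} {σ : ℕ → Term L} {m : ℕ}
    (hσ : ∀ n, (σ n).ClosedAt m) : ∀ n, (liftSub σ n).ClosedAt (m + 1)
  | 0 => Nat.succ_pos m
  | n + 1 => (hσ n).shiftUp

theorem liftSub_congr {L : Signature} {σ τ : ℕ → Term L} {k : ℕ} (h : ∀ n < k, σ n = τ n) :
    ∀ n < k + 1, liftSub σ n = liftSub τ n
  | 0, _ => rfl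
  | n + 1, hn => congrArg Term.shiftUp (h n (Nat.lt_of_succ_lt_succ hn))

namespace Formula

variable {L : Signature}

theorem applySub_var (φ : Formula L) : φ.applySub Term.var = φ := by
  induction φ with
  | rel R ts => simp only [applySub, Term.applySub_var]
  | _ => simp_all only [applySub, liftSub_var]

theorem applySub_applySub (φ : Formula L) (σ τ : ℕ → Term L) :
    (φ.applySub σ).applySub τ = φ.applySub fun n => (σ n).applySub τ := by
  induction φ generalizing σ τ with
  | rel R ts => simp only [applySub, Term.applySub_applySub]
  | _ => simp_all only [applySub, liftSub_comp]

theorem ClosedAt.mono {φ : Formula L} {k m : ℕ} (h : φ.ClosedAt k) (hkm : k ≤ m) :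
    φ.ClosedAt m := by
  induction φ generalizing k m with
  | top | bot => trivial
  | rel R ts => exact fun i => (h i).mono hkm
  | and φ ψ ih₁ ih₂ | or φ ψ ih₁ ih₂ | imp φ ψ ih₁ ih₂ => exact ⟨ih₁ h.1 hkm, ih₂ h.2 hkm⟩
  | all φ ih | ex φ ih => exact ih (k := k + 1) h (Nat.succ_le_succ hkm)

theorem closedAt_applySub (φ : Formula L) {σ : ℕ → Term L} {m : ℕ}
    (hσ : ∀ n, (σ n).ClosedAt m) : (φ.applySub σ).ClosedAt m := by
  induction φ generalizing σ m with
  | top | bot => trivial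
  | rel R ts => exact fun i => Term.closedAt_applySub hσ _
  | and φ ψ ih₁ ih₂ | or φ ψ ih₁ ih₂ | imp φ ψ ih₁ ih₂ => exact ⟨ih₁ hσ, ih₂ hσ⟩
  | all φ ih | ex φ ih => exact ih (closedAt_liftSub hσ)

theorem ClosedAt.applySub_congr {φ : Formula L} {k : ℕ} (h : φ.ClosedAt k) {σ τ : ℕ → Term L}
    (hστ : ∀ n < k, σ n = τ n) : φ.applySub σ = φ.applySub τ := by
  induction φ generalizing k σ τ with
  | top | bot => rfl
  | rel R ts =>
    simp only [applySub]
    congr 1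
    funext i
    exact (h i).applySub_congr hστ
  | and φ ψ ih₁ ih₂ | or φ ψ ih₁ ih₂ | imp φ ψ ih₁ ih₂ =>
    simp only [applySub, ih₁ h.1 hστ, ih₂ h.2 hστ]
  | all φ ih | ex φ ih =>
    simp only [applySub]
    rw [ih (k := k + 1) h (liftSub_congr hστ)]

theorem Sentence.applySub_eq {φ : Formula L} (h : φ.Sentence) (σ : ℕ → Term L) :
    φ.applySub σ = φ :=
  (ClosedAt.applySub_congr (k := 0) h fun _ hn => absurd hn (Nat.not_lt_zero _)).trans
    φ.applySub_var

theorem Sentence.subst0_eq {φ : Formula L} (h : φ.Sentence) (t : Term L) : subst0 φ t = φ :=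
  h.applySub_eq _

theorem ClosedAt.subst0 {φ : Formula L} (h : φ.ClosedAt 1) {t : Term L} (ht : t.Closed) :
    (subst0 φ t).Sentence := by
  have h' : BQL.subst0 φ t = φ.applySub fun _ => t :=
    h.applySub_congr fun n hn => by
      obtain rfl : n = 0 := by omega
      rfl
  rw [h']
  exact φ.closedAt_applySub fun _ => ht

theorem subst0_applySub_liftSub (φ : Formula L) (σ : ℕ → Term L) (t : Term L) :
    BQL.subst0 (φ.applySub (liftSub σ)) t = φ.applySub (vcons t σ) := by
  rw [subst0_eq, applySub_applySub]
  congr 1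
  funext n
  cases n with
  | zero => rfl
  | succ n => exact (Term.applySub_shiftUp _ _).trans (Term.applySub_var _)

theorem finite_occC (φ : Formula L) : {c | φ.OccC c}.Finite := by
  induction φ with
  | top | bot => exact Set.finite_empty
  | rel R ts =>
    refine (Set.finite_iUnion fun i => (ts i).finite_occC).subset ?_
    rintro c ⟨i, hi⟩
    exact Set.mem_iUnion.2 ⟨i, hi⟩
  | and φ ψ ih₁ ih₂ | or φ ψ ih₁ ih₂ | imp φ ψ ih₁ ih₂ => exact ih₁.union ih₂
  | all φ ih | ex φ ih => exact ih

theorem exists_fresh (φ : Formula L.plus) : ∃ i : ℕ, ¬ φ.OccC (Sum.inr i) :=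
  (φ.finite_occC.preimage (f := (Sum.inr : ℕ → L.Const ⊕ ℕ))
    Sum.inr_injective.injOn).exists_notMem

end Formula

/-! ### Countability -/

section Countability

variable {L : Signature}

private abbrev TermArity (L : Signature) : ℕ ⊕ L.Const ⊕ L.Func → Type
  | .inl _ => Fin 0
  | .inr (.inl _) => Fin 0
  | .inr (.inr f) => Fin (L.arityF f)

private instance (a : ℕ ⊕ L.Const ⊕ L.Func) : Fintype (TermArity L a) :=
  match a with
  | .inl _ => inferInstanceAs (Fintype (Fin 0))
  | .inr (.inl _) => inferInstanceAs (Fintype (Fin 0))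
  | .inr (.inr f) => inferInstanceAs (Fintype (Fin (L.arityF f)))

private instance (a : ℕ ⊕ L.Const ⊕ L.Func) : Encodable (TermArity L a) :=
  match a with
  | .inl _ => inferInstanceAs (Encodable (Fin 0))
  | .inr (.inl _) => inferInstanceAs (Encodable (Fin 0))
  | .inr (.inr f) => inferInstanceAs (Encodable (Fin (L.arityF f)))

private def Term.toW : Term L → WType (TermArity L)
  | .var n => ⟨.inl n, Fin.elim0⟩
  | .const c => ⟨.inr (.inl c), Fin.elim0⟩
  | .func f ts => ⟨.inr (.inr f), fun i => (ts i).toW⟩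

private theorem Term.toW_injective : Function.Injective (Term.toW (L := L)) := by
  intro s
  induction s with
  | var n => rintro (_ | _ | _) h <;> simp_all [Term.toW]
  | const c => rintro (_ | _ | _) h <;> simp_all [Term.toW]
  | func f ts ih =>
    rintro (_ | _ | ⟨g, us⟩) h
    · simp [Term.toW] at h
    · simp [Term.toW] at h
    · simp only [Term.toW, WType.mk.injEq, Sum.inr.injEq] at h
      obtain ⟨rfl, h⟩ := h
      congr 1
      funext i
      exact ih i (congrFun (eq_of_heq h) i)

theorem countable_term [Countable L.Const] [Countable L.Func] : Countable (Term L) := by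
  have := Encodable.ofCountable L.Const
  have := Encodable.ofCountable L.Func
  exact Term.toW_injective.countable

/-- Labels for the nodes of a formula's syntax tree, by number of subformulas. -/
private abbrev FormulaLabel (L : Signature) : Type :=
  (Bool ⊕ (R : L.Rel) × (Fin (L.arityR R) → Term L)) ⊕ Bool ⊕ Fin 3

private abbrev FormulaArity (L : Signature) : FormulaLabel L → Type
  | .inl _ => Fin 0
  | .inr (.inl _) => Fin 1
  | .inr (.inr _) => Fin 2

private instance (a : FormulaLabel L) : Fintype (FormulaArity L a) :=
  match a with
  | .inl _ => inferInstanceAs (Fintype (Fin 0))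
  | .inr (.inl _) => inferInstanceAs (Fintype (Fin 1))
  | .inr (.inr _) => inferInstanceAs (Fintype (Fin 2))

private instance (a : FormulaLabel L) : Encodable (FormulaArity L a) :=
  match a with
  | .inl _ => inferInstanceAs (Encodable (Fin 0))
  | .inr (.inl _) => inferInstanceAs (Encodable (Fin 1))
  | .inr (.inr _) => inferInstanceAs (Encodable (Fin 2))

private def Formula.toW : Formula L → WType (FormulaArity L)
  | .top => ⟨.inl (.inl true), Fin.elim0⟩
  | .bot => ⟨.inl (.inl false), Fin.elim0⟩
  | .rel R ts => ⟨.inl (.inr ⟨R, ts⟩), Fin.elim0⟩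
  | .all φ => ⟨.inr (.inl true), fun _ : Fin 1 => φ.toW⟩
  | .ex φ => ⟨.inr (.inl false), fun _ : Fin 1 => φ.toW⟩
  | .and φ ψ => ⟨.inr (.inr 0), fun i : Fin 2 => if i = 0 then φ.toW else ψ.toW⟩
  | .or φ ψ => ⟨.inr (.inr 1), fun i : Fin 2 => if i = 0 then φ.toW else ψ.toW⟩
  | .imp φ ψ => ⟨.inr (.inr 2), fun i : Fin 2 => if i = 0 then φ.toW else ψ.toW⟩

private theorem Formula.toW_injective : Function.Injective (Formula.toW (L := L)) := by
  intro φ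
  induction φ with
  | top | bot => rintro (_ | _ | _) h <;> simp_all [Formula.toW]
  | rel R ts => rintro (_ | _ | _) h <;> simp_all [Formula.toW]
  | all φ ih | ex φ ih =>
    rintro (_ | _ | _) h <;> simp [Formula.toW] at h
    exact congrArg _ (ih (congrFun h 0))
  | and φ ψ ih₁ ih₂ | or φ ψ ih₁ ih₂ | imp φ ψ ih₁ ih₂ =>
    rintro (_ | _ | _) h <;> simp [Formula.toW] at h
    exact congrArg₂ _ (ih₁ (congrFun h 0)) (ih₂ (congrFun h 1))

theorem countable_formula [Countable L.Const] [Countable L.Func] [Countable L.Rel] :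
    Countable (Formula L) := by
  have : Countable (Term L) := countable_term
  have := Encodable.ofCountable (FormulaLabel L)
  exact Formula.toW_injective.countable

theorem countable_formula_plus [Countable L.Const] [Countable L.Func] [Countable L.Rel] :
    Countable (Formula L.plus) := by
  have : Countable L.plus.Const := inferInstanceAs (Countable (L.Const ⊕ ℕ))
  have : Countable L.plus.Func := ‹Countable L.Func›
  have : Countable L.plus.Rel := ‹Countable L.Rel›
  exact countable_formula

end Countability

/-! ### Derivations without modus ponens -/

namespace PrfN

variable {L : Signature} {n : ℕ} {Γ Δ : Set (Formula L.plus)} {φ ψ χ : Formula L.plus}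

theorem cut (hφ : φ.Sentence) (h₁ : PrfN L n Γ Δ φ) (h₂ : PrfN L n Γ (insert φ Δ) ψ) :
    PrfN L n Γ Δ ψ :=
  orElim (orIntroL hφ h₁) h₂ h₂

private theorem finite_of_insert {s : Set (Formula L.plus)} (hs : s.Finite)
    (h : s ⊆ insert φ Δ) : ∃ t ⊆ Δ, t.Finite ∧ s ⊆ insert φ t :=
  ⟨s \ {φ}, by simpa using h, hs.sdiff, by simp⟩

/-- Compactness: a derivation without modus ponens uses finitely many assumptions. -/
theorem exists_finite (h : PrfN L n Γ Δ φ) (hn : n = 0) :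
    ∃ s ⊆ Γ ∪ Δ, s.Finite ∧ PrfN L 0 ∅ s φ := by
  have mono {s t : Set (Formula L.plus)} {φ : Formula L.plus} (hst : s ⊆ t)
      (h : PrfN L 0 ∅ s φ) : PrfN L 0 ∅ t φ := weaken subset_rfl hst h
  have sub {Γ Δ Γ' Δ' s : Set (Formula L.plus)} (hΓ : Γ ⊆ Γ') (hΔ : Δ ⊆ Δ')
      (hs : s ⊆ Γ ∪ Δ) : s ⊆ Γ' ∪ Δ' := hs.trans (Set.union_subset_union hΓ hΔ)
  have fresh {i : ℕ} {Γ Δ s : Set (Formula L.plus)} (hΓ : FreshIn i Γ) (hΔ : FreshIn i Δ)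
      (hs : s ⊆ Γ ∪ Δ) : FreshIn i s := fun ψ hψ => (hs hψ).elim (hΓ ψ) (hΔ ψ)
  have empty (i : ℕ) : FreshIn i (∅ : Set (Formula L.plus)) := fun _ h => h.elim
  have unary {Γ Δ : Set (Formula L.plus)} {φ ψ : Formula L.plus}
      (r : ∀ s, PrfN L 0 ∅ s φ → PrfN L 0 ∅ s ψ)
      (h : ∃ s ⊆ Γ ∪ Δ, s.Finite ∧ PrfN L 0 ∅ s φ) :
      ∃ s ⊆ Γ ∪ Δ, s.Finite ∧ PrfN L 0 ∅ s ψ :=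
    let ⟨s, h, hf, hp⟩ := h
    ⟨s, h, hf, r s hp⟩
  have binary {Γ Δ : Set (Formula L.plus)} {φ ψ χ : Formula L.plus}
      (r : ∀ s, PrfN L 0 ∅ s φ → PrfN L 0 ∅ s ψ → PrfN L 0 ∅ s χ)
      (h₁ : ∃ s ⊆ Γ ∪ Δ, s.Finite ∧ PrfN L 0 ∅ s φ)
      (h₂ : ∃ s ⊆ Γ ∪ Δ, s.Finite ∧ PrfN L 0 ∅ s ψ) :
      ∃ s ⊆ Γ ∪ Δ, s.Finite ∧ PrfN L 0 ∅ s χ :=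
    let ⟨s, h, hf, hp⟩ := h₁
    let ⟨t, h', hf', hp'⟩ := h₂
    ⟨s ∪ t, Set.union_subset h h', hf.union hf', r _ (mono Set.subset_union_left hp)
      (mono Set.subset_union_right hp')⟩
  have discharge {Γ Δ : Set (Formula L.plus)} {φ ψ : Formula L.plus}
      (h : ∃ s ⊆ Γ ∪ insert φ Δ, s.Finite ∧ PrfN L 0 ∅ s ψ) :
      ∃ s ⊆ Γ ∪ Δ, s.Finite ∧ PrfN L 0 ∅ (insert φ s) ψ := by
    obtain ⟨s, h, hf, hp⟩ := h
    rw [Set.union_insert] at h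
    obtain ⟨t, ht, htf, hst⟩ := finite_of_insert hf h
    exact ⟨t, ht, htf, mono hst hp⟩
  induction h with
  | @hyp n Γ Δ φ h hφ =>
    exact ⟨{φ}, by simpa using h, Set.finite_singleton _, hyp (by simp) hφ⟩
  | weaken hΓ hΔ _ ih =>
    obtain ⟨s, h, hf, hp⟩ := ih hn
    exact ⟨s, sub hΓ hΔ h, hf, hp⟩
  | topIntro => exact ⟨∅, Set.empty_subset _, Set.finite_empty, topIntro⟩
  | botElim hφ _ ih => exact unary (fun _ => botElim hφ) (ih hn)
  | andIntro _ _ ih₁ ih₂ => exact binary (fun _ => andIntro) (ih₁ hn) (ih₂ hn)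
  | andElimL _ ih => exact unary (fun _ => andElimL) (ih hn)
  | andElimR _ ih => exact unary (fun _ => andElimR) (ih hn)
  | orIntroL hψ _ ih => exact unary (fun _ => orIntroL hψ) (ih hn)
  | orIntroR hφ _ ih => exact unary (fun _ => orIntroR hφ) (ih hn)
  | orElim _ _ _ ih₁ ih₂ ih₃ =>
    obtain ⟨s, h, hf, hp⟩ := ih₁ hn
    obtain ⟨t, h', hf', hp'⟩ := discharge (ih₂ hn)
    obtain ⟨u, h'', hf'', hp''⟩ := discharge (ih₃ hn)
    refine ⟨s ∪ t ∪ u, Set.union_subset (Set.union_subset h h') h'',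
      (hf.union hf').union hf'', orElim (mono ?_ hp) (mono (Set.insert_subset_insert ?_) hp')
      (mono (Set.insert_subset_insert ?_) hp'')⟩
    · exact Set.subset_union_left.trans Set.subset_union_left
    · exact Set.subset_union_right.trans Set.subset_union_left
    · exact Set.subset_union_right
  | impIntro hφ _ ih =>
    obtain ⟨s, h, hf, hp⟩ := discharge (ih hn)
    exact ⟨s, h, hf, impIntro hφ hp⟩
  | impElim hm => omega
  | intTrans _ _ ih₁ ih₂ => exact binary (fun _ => intTrans) (ih₁ hn) (ih₂ hn)
  | intAndIntro _ _ ih₁ ih₂ => exact binary (fun _ => intAndIntro) (ih₁ hn) (ih₂ hn)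
  | intOrElim _ _ ih₁ ih₂ => exact binary (fun _ => intOrElim) (ih₁ hn) (ih₂ hn)
  | intAllIntro hφ _ ih => exact unary (fun _ => intAllIntro hφ) (ih hn)
  | intExElim hψ _ ih => exact unary (fun _ => intExElim hψ) (ih hn)
  | allIntro hΓ hΔ fΓ fΔ fφ _ ih =>
    obtain ⟨s, h, hf, hp⟩ := ih hn
    exact ⟨s, sub hΓ hΔ h, hf, allIntro subset_rfl subset_rfl (empty _) (fresh fΓ fΔ h) fφ hp⟩
  | allElim ht _ ih => exact unary (fun _ => allElim ht) (ih hn)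
  | cd hφ _ ih => exact unary (fun _ => cd hφ) (ih hn)
  | exIntro ht hφ _ ih => exact unary (fun _ => exIntro ht hφ) (ih hn)
  | exElim hΓ hΔ fΓ fΔ fφ fψ _ _ ih₁ ih₂ =>
    obtain ⟨s, h, hf, hp⟩ := ih₁ hn
    obtain ⟨t, h', hf', hp'⟩ := discharge (ih₂ hn)
    exact ⟨s ∪ t, Set.union_subset h (sub hΓ hΔ h'), hf.union hf',
      exElim subset_rfl Set.subset_union_right (empty _) (fresh fΓ fΔ h') fφ fψ
        (mono Set.subset_union_left hp) hp'⟩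

/-- Distributivity of `∧` over `∨`. -/
theorem and_or_distrib (hφ : φ.Sentence) (hψ : ψ.Sentence) (hχ : χ.Sentence) :
    PrfN L n ∅ (insert (.and φ (.or ψ χ)) ∅) (.or ψ (.and φ χ)) := by
  have hs : (Formula.and φ (.or ψ χ)).Sentence := ⟨hφ, hψ, hχ⟩
  refine orElim (andElimR (φ := φ) (hyp (by simp) hs)) (orIntroL ⟨hφ, hχ⟩ (hyp (by simp) hψ))
    (orIntroR hψ (andIntro (andElimL (ψ := .or ψ χ) (hyp (by simp) hs)) (hyp (by simp) hχ)))

/-- Distributivity of `∧` over `∃`. -/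
theorem and_ex_distrib (hφ : φ.Sentence) (hψ : (Formula.ex ψ).Sentence) :
    PrfN L n ∅ (insert (.and φ (.ex ψ)) ∅) (.ex (.and φ ψ)) := by
  have hs : (Formula.and φ (.ex ψ)).Sentence := ⟨hφ, hψ⟩
  obtain ⟨i, hi⟩ := Formula.exists_fresh (.and φ (.ex ψ))
  refine exElim (φ := ψ) (i := i) subset_rfl subset_rfl (fun _ h => h.elim) (by simpa [FreshIn] using hi)
    (fun h => hi (.inr h)) hi (andElimR (φ := φ) (hyp (by simp) hs)) ?_
  refine exIntro (t := aconst L i) trivial ⟨hφ.mono (Nat.zero_le _), hψ⟩ ?_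
  change PrfN L n ∅ _ (.and (subst0 φ _) (subst0 ψ _))
  rw [hφ.subst0_eq]
  exact andIntro (andElimL (ψ := .ex ψ) (hyp (by simp) hs))
    (hyp (by simp) (Formula.ClosedAt.subst0 hψ trivial))

end PrfN

/-! ### The order on sentences induced by a theory -/

namespace PST

variable {L : Signature} {Γ : Set (Formula L.plus)} {α β χ φ : Formula L.plus}

theorem sentence (hΓ : PST L Γ) (h : φ ∈ Γ) : φ.Sentence := hΓ.1 φ h

theorem bot_notMem (hΓ : PST L Γ) : Formula.bot ∉ Γ := hΓ.2.1

theorem mem_of_prv (hΓ : PST L Γ) (hφ : φ.Sentence) (h : PrfN L 0 Γ ∅ φ) : φ ∈ Γ :=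
  hΓ.2.2.1 φ hφ h

theorem prv (hΓ : PST L Γ) (h : φ ∈ Γ) : PrfN L 0 Γ ∅ φ := .hyp (.inl h) (hΓ.sentence h)

theorem all_mem (hΓ : PST L Γ) (hφ : φ.ClosedAt 1)
    (h : ∀ t : Term L.plus, t.Closed → subst0 φ t ∈ Γ) : Formula.all φ ∈ Γ :=
  hΓ.2.2.2.2.2 φ hφ h

theorem and_mem_iff (hΓ : PST L Γ) : Formula.and α β ∈ Γ ↔ α ∈ Γ ∧ β ∈ Γ :=
  ⟨fun h => ⟨hΓ.mem_of_prv (hΓ.sentence h).1 (.andElimL (hΓ.prv h)),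
    hΓ.mem_of_prv (hΓ.sentence h).2 (.andElimR (hΓ.prv h))⟩,
   fun h => hΓ.mem_of_prv ⟨hΓ.sentence h.1, hΓ.sentence h.2⟩
    (.andIntro (hΓ.prv h.1) (hΓ.prv h.2))⟩

theorem or_mem_iff (hΓ : PST L Γ) (hα : α.Sentence) (hβ : β.Sentence) :
    Formula.or α β ∈ Γ ↔ α ∈ Γ ∨ β ∈ Γ :=
  ⟨hΓ.2.2.2.1 α β, fun h => hΓ.mem_of_prv ⟨hα, hβ⟩ (h.elim
    (fun h => .orIntroL hβ (hΓ.prv h)) fun h => .orIntroR hα (hΓ.prv h))⟩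

theorem all_mem_iff (hΓ : PST L Γ) (hφ : φ.ClosedAt 1) :
    Formula.all φ ∈ Γ ↔ ∀ t : Term L.plus, t.Closed → subst0 φ t ∈ Γ :=
  ⟨fun h _ ht => hΓ.mem_of_prv (hφ.subst0 ht) (.allElim ht (hΓ.prv h)), hΓ.all_mem hφ⟩

theorem ex_mem_iff (hΓ : PST L Γ) (hφ : φ.ClosedAt 1) :
    Formula.ex φ ∈ Γ ↔ ∃ t : Term L.plus, t.Closed ∧ subst0 φ t ∈ Γ :=
  ⟨hΓ.2.2.2.2.1 φ, fun ⟨_, ht, h⟩ => hΓ.mem_of_prv hφ (.exIntro ht hφ (hΓ.prv h))⟩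

theorem imp_mem_of_prv (hΓ : PST L Γ) (hα : α.Sentence) (hβ : β.Sentence)
    (h : PrfN L 0 ∅ (insert α ∅) β) : Formula.imp α β ∈ Γ :=
  hΓ.mem_of_prv ⟨hα, hβ⟩ (.impIntro hα (.weaken (Set.empty_subset _) subset_rfl h))

theorem imp_refl (hΓ : PST L Γ) (hα : α.Sentence) : Formula.imp α α ∈ Γ :=
  hΓ.imp_mem_of_prv hα hα (.hyp (by simp) hα)

theorem imp_trans (hΓ : PST L Γ) (h₁ : Formula.imp α β ∈ Γ) (h₂ : Formula.imp β χ ∈ Γ) :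
    Formula.imp α χ ∈ Γ :=
  hΓ.mem_of_prv ⟨(hΓ.sentence h₁).1, (hΓ.sentence h₂).2⟩ (.intTrans (hΓ.prv h₁) (hΓ.prv h₂))

theorem imp_and (hΓ : PST L Γ) (h₁ : Formula.imp α β ∈ Γ) (h₂ : Formula.imp α χ ∈ Γ) :
    Formula.imp α (.and β χ) ∈ Γ :=
  hΓ.mem_of_prv ⟨(hΓ.sentence h₁).1, (hΓ.sentence h₁).2, (hΓ.sentence h₂).2⟩
    (.intAndIntro (hΓ.prv h₁) (hΓ.prv h₂))

theorem or_imp (hΓ : PST L Γ) (h₁ : Formula.imp α χ ∈ Γ) (h₂ : Formula.imp β χ ∈ Γ) :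
    Formula.imp (.or α β) χ ∈ Γ :=
  hΓ.mem_of_prv ⟨⟨(hΓ.sentence h₁).1, (hΓ.sentence h₂).1⟩, (hΓ.sentence h₁).2⟩
    (.intOrElim (hΓ.prv h₁) (hΓ.prv h₂))

theorem and_imp_left (hΓ : PST L Γ) (hα : α.Sentence) (hβ : β.Sentence) :
    Formula.imp (.and α β) α ∈ Γ :=
  hΓ.imp_mem_of_prv ⟨hα, hβ⟩ hα (.andElimL (ψ := β) (.hyp (by simp) ⟨hα, hβ⟩))

theorem and_imp_right (hΓ : PST L Γ) (hα : α.Sentence) (hβ : β.Sentence) :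
    Formula.imp (.and α β) β ∈ Γ :=
  hΓ.imp_mem_of_prv ⟨hα, hβ⟩ hβ (.andElimR (φ := α) (.hyp (by simp) ⟨hα, hβ⟩))

theorem imp_or_left (hΓ : PST L Γ) (hα : α.Sentence) (hβ : β.Sentence) :
    Formula.imp α (.or α β) ∈ Γ :=
  hΓ.imp_mem_of_prv hα ⟨hα, hβ⟩ (.orIntroL hβ (.hyp (by simp) hα))

theorem imp_or_right (hΓ : PST L Γ) (hα : α.Sentence) (hβ : β.Sentence) :
    Formula.imp β (.or α β) ∈ Γ :=
  hΓ.imp_mem_of_prv hβ ⟨hα, hβ⟩ (.orIntroR hα (.hyp (by simp) hβ))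

/-- The lattice form of cut. -/
theorem imp_of_and_imp_of_imp_or (hΓ : PST L Γ) (h₁ : Formula.imp (.and α χ) β ∈ Γ)
    (h₂ : Formula.imp α (.or β χ) ∈ Γ) : Formula.imp α β ∈ Γ := by
  obtain ⟨⟨hα, hχ⟩, hβ⟩ := hΓ.sentence h₁
  exact hΓ.imp_trans (hΓ.imp_and (hΓ.imp_refl hα) h₂) <|
    hΓ.imp_trans (hΓ.imp_mem_of_prv (α := .and α (.or β χ)) (β := .or β (.and α χ))
      ⟨hα, hβ, hχ⟩ ⟨hβ, hα, hχ⟩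
      (.and_or_distrib hα hβ hχ)) (hΓ.or_imp (hΓ.imp_refl hβ) h₁)

theorem and_ex_imp (hΓ : PST L Γ) (hα : α.Sentence) (hβ : β.Sentence) (hφ : φ.ClosedAt 1)
    (h : ∀ t : Term L.plus, t.Closed → Formula.imp (.and α (subst0 φ t)) β ∈ Γ) :
    Formula.imp (.and α (.ex φ)) β ∈ Γ := by
  have hα₁ : α.ClosedAt 1 := hα.mono (Nat.zero_le _)
  have hall : Formula.all (.imp (.and α φ) β) ∈ Γ := by
    refine hΓ.all_mem ⟨⟨hα₁, hφ⟩, hβ.mono (Nat.zero_le _)⟩ fun t ht => ?_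
    change Formula.imp (.and (subst0 α t) (subst0 φ t)) (subst0 β t) ∈ Γ
    rw [hα.subst0_eq, hβ.subst0_eq]
    exact h t ht
  exact hΓ.imp_trans
    (hΓ.imp_mem_of_prv (β := .ex (.and α φ)) ⟨hα, hφ⟩ ⟨hα₁, hφ⟩ (.and_ex_distrib hα hφ))
    (hΓ.mem_of_prv ⟨⟨hα₁, hφ⟩, hβ⟩ (.intExElim hβ (hΓ.prv hall)))

theorem imp_or_all (hΓ : PST L Γ) (hα : α.Sentence) (hβ : β.Sentence) (hφ : φ.ClosedAt 1)
    (h : ∀ t : Term L.plus, t.Closed → Formula.imp α (.or β (subst0 φ t)) ∈ Γ) :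
    Formula.imp α (.or β (.all φ)) ∈ Γ := by
  have hβ₁ : β.ClosedAt 1 := hβ.mono (Nat.zero_le _)
  have hall : Formula.all (.imp α (.or β φ)) ∈ Γ := by
    refine hΓ.all_mem ⟨hα.mono (Nat.zero_le _), hβ₁, hφ⟩ fun t ht => ?_
    change Formula.imp (subst0 α t) (.or (subst0 β t) (subst0 φ t)) ∈ Γ
    rw [hα.subst0_eq, hβ.subst0_eq]
    exact h t ht
  have hs : (Formula.all (.or β φ)).Sentence := ⟨hβ₁, hφ⟩
  exact hΓ.imp_trans (hΓ.mem_of_prv ⟨hα, hs⟩ (.intAllIntro hα (hΓ.prv hall)))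
    (hΓ.imp_mem_of_prv hs ⟨hβ, hφ⟩ (.cd hβ (.hyp (by simp) hs)))

theorem imp_of_prv_finite (hΓ : PST L Γ) {s : Set (Formula L.plus)} (hs : s.Finite)
    (hα : α.Sentence) (hχ : χ.Sentence) (hαs : ∀ σ ∈ s, Formula.imp α σ ∈ Γ)
    (h : PrfN L 0 ∅ (insert α s) χ) : Formula.imp α χ ∈ Γ := by
  induction s, hs using Set.Finite.induction_on generalizing α with
  | empty => exact hΓ.imp_mem_of_prv hα hχ h
  | @insert σ s _ _ ih =>
    have hασ := hαs σ (Set.mem_insert _ _)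
    have hσ : σ.Sentence := (hΓ.sentence hασ).2
    refine hΓ.imp_trans (hΓ.imp_and (hΓ.imp_refl hα) hασ) (ih ⟨hα, hσ⟩ (fun τ hτ =>
      hΓ.imp_trans (hΓ.and_imp_left hα hσ) (hαs τ (Set.mem_insert_of_mem _ hτ))) ?_)
    refine .cut hα (.andElimL (ψ := σ) (.hyp (by simp) ⟨hα, hσ⟩)) (.cut hσ
      (.andElimR (φ := α) (.hyp (by simp) ⟨hα, hσ⟩)) (.weaken subset_rfl ?_ h))
    intro τ
    simp only [Set.mem_insert_iff]
    tauto

end PST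

/-! ### Extension of a theory along the canonical accessibility relation -/

/-- A pair of sentences not related by the order induced by the theory `Γ`. -/
structure SepPair {L : Signature} (Γ : (CModel L).W) where
  pos : Formula L.plus
  neg : Formula L.plus
  pos_sentence : pos.Sentence
  neg_sentence : neg.Sentence
  imp_notMem : Formula.imp pos neg ∉ Γ.1

namespace SepPair

variable {L : Signature} {Γ : (CModel L).W}

instance : Preorder (SepPair Γ) where
  le p q := Formula.imp q.pos p.pos ∈ Γ.1 ∧ Formula.imp p.neg q.neg ∈ Γ.1
  le_refl p := ⟨Γ.2.imp_refl p.pos_sentence, Γ.2.imp_refl p.neg_sentence⟩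
  le_trans _ _ _ h₁ h₂ := ⟨Γ.2.imp_trans h₂.1 h₁.1, Γ.2.imp_trans h₁.2 h₂.2⟩

/-- The pair puts `χ` on one of its sides, with a witness if `χ` is existential on the positive
side or universal on the negative side. -/
def Decides (p : SepPair Γ) (χ : Formula L.plus) : Prop :=
  (Formula.imp p.pos χ ∈ Γ.1 ∧ ∀ θ, χ = .ex θ →
    ∃ t : Term L.plus, t.Closed ∧ Formula.imp p.pos (subst0 θ t) ∈ Γ.1) ∨
  (Formula.imp χ p.neg ∈ Γ.1 ∧ ∀ θ, χ = .all θ →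
    ∃ t : Term L.plus, t.Closed ∧ Formula.imp (subst0 θ t) p.neg ∈ Γ.1)

theorem le_pos (p : SepPair Γ) {χ : Formula L.plus} (hχ : χ.Sentence)
    (h : Formula.imp (.and p.pos χ) p.neg ∉ Γ.1) :
    ∃ q, p ≤ q ∧ Formula.imp q.pos χ ∈ Γ.1 :=
  ⟨⟨.and p.pos χ, p.neg, ⟨p.pos_sentence, hχ⟩, p.neg_sentence, h⟩,
    ⟨Γ.2.and_imp_left p.pos_sentence hχ, Γ.2.imp_refl p.neg_sentence⟩,
    Γ.2.and_imp_right p.pos_sentence hχ⟩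

theorem le_neg (p : SepPair Γ) {χ : Formula L.plus} (hχ : χ.Sentence)
    (h : Formula.imp p.pos (.or p.neg χ) ∉ Γ.1) :
    ∃ q, p ≤ q ∧ Formula.imp χ q.neg ∈ Γ.1 :=
  ⟨⟨p.pos, .or p.neg χ, p.pos_sentence, ⟨p.neg_sentence, hχ⟩, h⟩,
    ⟨Γ.2.imp_refl p.pos_sentence, Γ.2.imp_or_left p.neg_sentence hχ⟩,
    Γ.2.imp_or_right p.neg_sentence hχ⟩

theorem exists_ge_decides (p : SepPair Γ) {χ : Formula L.plus} (hχ : χ.Sentence) :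
    ∃ q, p ≤ q ∧ q.Decides χ := by
  by_cases h : Formula.imp (.and p.pos χ) p.neg ∈ Γ.1
  · obtain ⟨q, hpq, hq⟩ :=
      p.le_neg hχ fun h' => p.imp_notMem (Γ.2.imp_of_and_imp_of_imp_or h h')
    by_cases hall : ∃ θ, χ = .all θ
    · obtain ⟨θ, rfl⟩ := hall
      obtain ⟨t, ht, hn⟩ : ∃ t : Term L.plus, t.Closed ∧
          Formula.imp q.pos (.or q.neg (subst0 θ t)) ∉ Γ.1 := by
        by_contra! hc
        exact q.imp_notMem <| Γ.2.imp_trans (Γ.2.imp_or_all q.pos_sentence q.neg_sentence hχ hc)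
          (Γ.2.or_imp (Γ.2.imp_refl q.neg_sentence) hq)
      obtain ⟨r, hqr, hr⟩ := q.le_neg (Formula.ClosedAt.subst0 hχ ht) hn
      exact ⟨r, hpq.trans hqr, .inr ⟨Γ.2.imp_trans hq hqr.2, by rintro _ ⟨⟩; exact ⟨t, ht, hr⟩⟩⟩
    · exact ⟨q, hpq, .inr ⟨hq, fun θ hθ => (hall ⟨θ, hθ⟩).elim⟩⟩
  · obtain ⟨q, hpq, hq⟩ := p.le_pos hχ h
    by_cases hex : ∃ θ, χ = .ex θ
    · obtain ⟨θ, rfl⟩ := hex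
      obtain ⟨t, ht, hn⟩ : ∃ t : Term L.plus, t.Closed ∧
          Formula.imp (.and q.pos (subst0 θ t)) q.neg ∉ Γ.1 := by
        by_contra! hc
        exact q.imp_notMem <| Γ.2.imp_trans (Γ.2.imp_and (Γ.2.imp_refl q.pos_sentence) hq)
          (Γ.2.and_ex_imp q.pos_sentence q.neg_sentence hχ hc)
      obtain ⟨r, hqr, hr⟩ := q.le_pos (Formula.ClosedAt.subst0 hχ ht) hn
      exact ⟨r, hpq.trans hqr, .inl ⟨Γ.2.imp_trans hqr.1 hq, by rintro _ ⟨⟩; exact ⟨t, ht, hr⟩⟩⟩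
    · exact ⟨q, hpq, .inl ⟨hq, fun θ hθ => (hex ⟨θ, hθ⟩).elim⟩⟩

/-- The sentences implied by the positive side of some pair in the ideal. -/
def theory (G : Order.Ideal (SepPair Γ)) : Set (Formula L.plus) :=
  {χ | ∃ p ∈ G, Formula.imp p.pos χ ∈ Γ.1}

variable {G : Order.Ideal (SepPair Γ)}

theorem notMem_theory {p : SepPair Γ} (hp : p ∈ G) {χ : Formula L.plus}
    (h : Formula.imp χ p.neg ∈ Γ.1) : χ ∉ theory G := by
  rintro ⟨q, hq, hqχ⟩
  obtain ⟨r, -, hpr, hqr⟩ := G.directed p hp q hq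
  exact r.imp_notMem (Γ.2.imp_trans hqr.1 (Γ.2.imp_trans hqχ (Γ.2.imp_trans h hpr.2)))

theorem exists_imp_of_finite {s : Set (Formula L.plus)} (hs : s.Finite) (hsG : s ⊆ theory G) :
    ∃ p ∈ G, ∀ σ ∈ s, Formula.imp p.pos σ ∈ Γ.1 := by
  induction s, hs using Set.Finite.induction_on with
  | empty =>
    obtain ⟨p, hp⟩ := G.nonempty
    exact ⟨p, hp, fun _ h => h.elim⟩
  | @insert σ s _ _ ih =>
    obtain ⟨p, hp, hps⟩ := ih fun _ h => hsG (Set.mem_insert_of_mem _ h)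
    obtain ⟨q, hq, hqσ⟩ := hsG (Set.mem_insert _ _)
    obtain ⟨r, hr, hpr, hqr⟩ := G.directed p hp q hq
    refine ⟨r, hr, ?_⟩
    rintro τ (rfl | hτ)
    · exact Γ.2.imp_trans hqr.1 hqσ
    · exact Γ.2.imp_trans hpr.1 (hps τ hτ)

theorem theory_pst (hG : ∀ χ : Formula L.plus, χ.Sentence → ∃ p ∈ G, p.Decides χ) :
    PST L (theory G) := by
  have sentence : ∀ χ ∈ theory G, χ.Sentence := fun χ ⟨_, _, h⟩ => (Γ.2.sentence h).2
  refine ⟨sentence, ?_, ?_, ?_, ?_, ?_⟩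
  · obtain ⟨p, hp⟩ := G.nonempty
    exact notMem_theory hp (Γ.2.imp_mem_of_prv trivial p.neg_sentence
      (.botElim p.neg_sentence (.hyp (by simp) trivial)))
  · intro χ hχ h
    obtain ⟨s, hsG, hs, h⟩ := PrfN.exists_finite h rfl
    obtain ⟨p, hp, hps⟩ := exists_imp_of_finite hs (by simpa using hsG)
    exact ⟨p, hp, Γ.2.imp_of_prv_finite hs p.pos_sentence hχ hps
      (.weaken subset_rfl (Set.subset_insert _ _) h)⟩
  · intro φ ψ h
    obtain ⟨hφ, hψ⟩ := sentence _ h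
    obtain ⟨p, hp, ⟨h₁, -⟩ | ⟨h₁, -⟩⟩ := hG φ hφ
    · exact .inl ⟨p, hp, h₁⟩
    obtain ⟨q, hq, ⟨h₂, -⟩ | ⟨h₂, -⟩⟩ := hG ψ hψ
    · exact .inr ⟨q, hq, h₂⟩
    obtain ⟨r, hr, hpr, hqr⟩ := G.directed p hp q hq
    exact (notMem_theory hr
      (Γ.2.or_imp (Γ.2.imp_trans h₁ hpr.2) (Γ.2.imp_trans h₂ hqr.2)) h).elim
  · intro φ h
    obtain ⟨p, hp, ⟨-, h'⟩ | ⟨h', -⟩⟩ := hG _ (sentence _ h)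
    · obtain ⟨t, ht, htp⟩ := h' φ rfl
      exact ⟨t, ht, p, hp, htp⟩
    · exact (notMem_theory hp h' h).elim
  · intro φ hφ h
    obtain ⟨p, hp, ⟨h', -⟩ | ⟨-, h'⟩⟩ := hG (.all φ) hφ
    · exact ⟨p, hp, h'⟩
    · obtain ⟨t, ht, htp⟩ := h' φ rfl
      exact (notMem_theory hp htp (h t ht)).elim

end SepPair

theorem exists_acc_of_imp_notMem {L : Signature}
    [Countable L.Const] [Countable L.Func] [Countable L.Rel]
    (Γ : (CModel L).W) {φ ψ : Formula L.plus} (hφ : φ.Sentence) (hψ : ψ.Sentence)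
    (h : Formula.imp φ ψ ∉ Γ.1) :
    ∃ Δ : (CModel L).W, (CModel L).acc Γ Δ ∧ φ ∈ Δ.1 ∧ ψ ∉ Δ.1 := by
  have : Countable (Formula L.plus) := countable_formula_plus
  have := Encodable.ofCountable {χ : Formula L.plus // χ.Sentence}
  let p : SepPair Γ := ⟨φ, ψ, hφ, hψ, h⟩
  let D (χ : {χ : Formula L.plus // χ.Sentence}) : Order.Cofinal (SepPair Γ) :=
    ⟨{q | q.Decides χ.1}, fun q =>
      let ⟨r, hqr, hr⟩ := q.exists_ge_decides χ.2
      ⟨r, hr, hqr⟩⟩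
  let G := Order.idealOfCofinals p D
  have hp : p ∈ G := Order.mem_idealOfCofinals p D
  have hG : ∀ χ : Formula L.plus, χ.Sentence → ∃ q ∈ G, q.Decides χ := fun χ hχ =>
    let ⟨q, hq, hqG⟩ := Order.cofinal_meets_idealOfCofinals p D ⟨χ, hχ⟩
    ⟨q, hqG, hq⟩
  exact ⟨⟨SepPair.theory G, SepPair.theory_pst hG⟩,
    fun α β hαβ ⟨q, hq, hqα⟩ => ⟨q, hq, Γ.2.imp_trans hqα hαβ⟩,
    ⟨p, hp, Γ.2.imp_refl hφ⟩, SepPair.notMem_theory hp (Γ.2.imp_refl hψ)⟩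

/-! ### Satisfaction in the canonical model -/

theorem eval_cModel {L : Signature} (ρ : ℕ → (CModel L).D) (t : Term L.plus) :
    (t.eval (CModel L) ρ).1 = t.applySub fun n => (ρ n).1 := by
  induction t with
  | var n => rfl
  | const c => rfl
  | func f ts ih => exact congrArg (Term.func f) (funext ih)

theorem vcons_val {L : Signature} (d : (CModel L).D) (ρ : ℕ → (CModel L).D) :
    (fun n => (vcons d ρ n).1) = vcons d.1 fun n => (ρ n).1 := by
  funext n
  cases n <;> rfl

theorem sat_cModel_iff {L : Signature}
    [Countable L.Const] [Countable L.Func] [Countable L.Rel]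
    (φ : Formula L.plus) (Γ : (CModel L).W) (ρ : ℕ → (CModel L).D) :
    Sat (CModel L) Γ ρ φ ↔ φ.applySub (fun n => (ρ n).1) ∈ Γ.1 := by
  have sentence (φ : Formula L.plus) (ρ : ℕ → (CModel L).D) :
      (φ.applySub fun n => (ρ n).1).Sentence := φ.closedAt_applySub fun n => (ρ n).2
  have closed (φ : Formula L.plus) (ρ : ℕ → (CModel L).D) :
      (φ.applySub (liftSub fun n => (ρ n).1)).ClosedAt 1 :=
    φ.closedAt_applySub (closedAt_liftSub fun n => (ρ n).2)
  induction φ generalizing Γ ρ with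
  | top => exact iff_of_true trivial (Γ.2.mem_of_prv trivial .topIntro)
  | bot => exact iff_of_false id Γ.2.bot_notMem
  | rel R ts =>
    change Formula.rel R (fun i => ((ts i).eval (CModel L) ρ).1) ∈ Γ.1 ↔ _
    simp only [eval_cModel, Formula.applySub]
  | and φ ψ ih₁ ih₂ => simp only [Sat, Formula.applySub, ih₁, ih₂, Γ.2.and_mem_iff]
  | or φ ψ ih₁ ih₂ =>
    simp only [Sat, Formula.applySub, ih₁, ih₂, Γ.2.or_mem_iff (sentence φ ρ) (sentence ψ ρ)]
  | imp φ ψ ih₁ ih₂ =>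
    simp only [Sat, Formula.applySub, ih₁, ih₂]
    refine ⟨fun h => ?_, fun h Δ hΔ => hΔ _ _ h⟩
    by_contra hn
    obtain ⟨Δ, hΔ, hφ, hψ⟩ := exists_acc_of_imp_notMem Γ (sentence φ ρ) (sentence ψ ρ) hn
    exact hψ (h Δ hΔ hφ)
  | all φ ih =>
    simp only [Sat, Formula.applySub, ih, Γ.2.all_mem_iff (closed φ ρ), vcons_val,
      Formula.subst0_applySub_liftSub]
    exact Subtype.forall
  | ex φ ih =>
    simp only [Sat, Formula.applySub, ih, Γ.2.ex_mem_iff (closed φ ρ), vcons_val,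
      Formula.subst0_applySub_liftSub]
    exact Subtype.exists.trans (by simp only [exists_prop])

/-- **Truth Lemma** (Lemma 13): in the canonical model `C`, for every prime saturated
`BQL_CD`-theory `Γ` and `L⁺`-sentence `φ`: `C, Γ ⊩ φ` iff `φ ∈ Γ`. -/
theorem truth_lemma {L : Signature}
    [Countable L.Const] [Countable L.Func] [Countable L.Rel]
    (Γ : Set (Formula L.plus)) (hΓ : PST L Γ) (φ : Formula L.plus)
    (hφ : φ.Sentence) :
    SatS (CModel L) ⟨Γ, hΓ⟩ φ ↔ φ ∈ Γ := by
  have key (ρ : ℕ → (CModel L).D) : Sat (CModel L) ⟨Γ, hΓ⟩ ρ φ ↔ φ ∈ Γ := by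
    have h := sat_cModel_iff φ ⟨Γ, hΓ⟩ ρ
    rwa [hφ.applySub_eq] at h
  exact ⟨fun h => (key _).1 (h fun _ => ⟨aconst L 0, trivial⟩), fun h ρ => (key ρ).2 h⟩

end BQL
end

section
/- Intersection Lemma: Let M be an L-model, I a nonempty index set, and {w} ∪ {u_i : i ∈ I} worlds of M such that (i) |R|(w) = ⋂_{i∈I} |R|(u_i) for every relation symbol R, (ii) every u_i is reflexive, (iii) w ≺ u_i for every i ∈ I, and (iv) whenever w ≺ z and z ≠ w, there is some i ∈ I with u_i ≺ z. Then for every L-formula φ(v̄) containing no occurrence of ∨ and no occurrence of ∃, and every tuple ā from the domain: w ⊩ φ(ā) if and only if u_i ⊩ φ(ā) for all i ∈ I. -/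
universe u v

namespace BQL

/-- **Intersection** (Lemma 16): if (i) `|R|(w) = ⋂ᵢ |R|(uᵢ)` for every relation
symbol `R`, (ii) every `uᵢ` is reflexive, (iii) `w ≺ uᵢ` for every `i`, and (iv)
whenever `w ≺ z` and `z ≠ w` there is some `i` with `uᵢ ≺ z`, then for every `∨`-free
and `∃`-free formula `φ`: `w ⊩ φ(ā)` iff `uᵢ ⊩ φ(ā)` for all `i`. -/
theorem intersection {L : Signature} (M : KModel.{u} L) (hM : M.Proper)
    {I : Type v} (hI : Nonempty I) (w : M.W) (u' : I → M.W)
    (h1 : ∀ R : L.Rel, M.interpR R w = ⋂ i, M.interpR R (u' i))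
    (h2 : ∀ i, M.acc (u' i) (u' i))
    (h3 : ∀ i, M.acc w (u' i))
    (h4 : ∀ z, M.acc w z → z ≠ w → ∃ i, M.acc (u' i) z)
    (φ : Formula L) (hφ : φ.NoOrEx) (ρ : ℕ → M.D) :
    Sat M w ρ φ ↔ ∀ i, Sat M (u' i) ρ φ := by
  induction φ generalizing ρ with
  | top => simp [Sat]
  | bot => simp [Sat]
  | rel R ts => simp only [Sat, h1, Set.mem_iInter]
  | and φ ψ ihφ ihψ =>
    simp only [Sat, ihφ hφ.1, ihψ hφ.2, forall_and]
  | or φ ψ => exact hφ.elim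
  | ex φ => exact hφ.elim
  | all φ ih =>
    simp only [Sat, ih hφ]
    exact forall_comm
  | imp φ ψ ihφ ihψ =>
    refine ⟨fun h i z hz => h z (hM.2.2.1 (h3 i) hz), fun h z hz hzφ => ?_⟩
    by_cases hzw : z = w
    · subst hzw
      exact (ihψ hφ.2 ρ).2 fun i => h i (u' i) (h2 i) ((ihφ hφ.1 ρ).1 hzφ i)
    · obtain ⟨i, hi⟩ := h4 z hz hzw
      exact h i z hi hzφ

end BQL
end
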